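/- Let a, b, c, d be complex numbers such that a and b are not integers and d is not a nonpositive integer. Then for every complex x, ₁F₁(a; b; x) · ₁F₁(c; d; −x) = ∑_{k=0}^∞ [ (a)_k x^k / (k! (b)_k) ] · ( ∑_{j=0}^k [ (−k)_j (1−k−b)_j (c)_j ] / [ (1−k−a)_j (d)_j j! ] ). -/

import Mathlib

/-- Pochhammer symbol `(a)_k` for complex `a`. -/
noncomputable def pochC (a : ℂ) (k : ℕ) : ℂ := (ascPochhammer ℂ k).eval a

/-- Confluent hypergeometric series `₁F₁(a; b; x)`. -/
noncomputable def hyp1F1 (a b x : ℂ) : ℂ :=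
  ∑' k : ℕ, pochC a k * x ^ k / (pochC b k * (Nat.factorial k : ℂ))

open Filter Topology in
theorem inv_tendsto_aux (b : ℂ) :
    Tendsto (fun n : ℕ => (b + (n : ℂ))⁻¹) atTop (𝓝 0) := by
  apply tendsto_inv₀_cobounded.comp
  rw [← tendsto_norm_atTop_iff_cobounded]
  have h : Tendsto (fun n : ℕ => (n : ℝ) - ‖b‖) atTop atTop :=
    tendsto_atTop_add_const_right _ _ tendsto_natCast_atTop_atTop
  refine tendsto_atTop_mono (fun n => ?_) h
  have := norm_sub_norm_le (n : ℂ) (-b)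
  simp only [norm_neg, sub_neg_eq_add, Complex.norm_natCast] at this
  rwa [add_comm (n : ℂ) b] at this

theorem pochC_succ (a : ℂ) (n : ℕ) : pochC a (n + 1) = pochC a n * (a + n) := by
  simp [pochC, ascPochhammer_succ_eval]

theorem pochC_succ_left (a : ℂ) (n : ℕ) : pochC a (n + 1) = a * pochC (a + 1) n := by
  simp [pochC, ascPochhammer_succ_left, Polynomial.eval_comp]

theorem pochC_zero (a : ℂ) : pochC a 0 = 1 := by simp [pochC]

theorem pochC_ne_zero (a : ℂ) (h : ∀ k : ℕ, a ≠ -(k : ℂ)) (n : ℕ) : pochC a n ≠ 0 := by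
  induction n with
  | zero => simp [pochC_zero]
  | succ n ih =>
    rw [pochC_succ]
    exact mul_ne_zero ih (fun h' => h n (eq_neg_of_add_eq_zero_left h'))

theorem pochC_one (n : ℕ) : pochC 1 n = (Nat.factorial n : ℂ) := by
  induction n with
  | zero => simp [pochC_zero]
  | succ n ih => rw [pochC_succ, ih, Nat.factorial_succ]; push_cast; ring

theorem pochC_reverse (b : ℂ) (m j : ℕ) :
    pochC (1 - ((m + j : ℕ) : ℂ) - b) j * pochC b m = (-1) ^ j * pochC b (m + j) := by
  induction j with
  | zero => simp [pochC_zero]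
  | succ j ih =>
    rw [pochC_succ_left, ← add_assoc m j 1, pochC_succ,
      show 1 - ((m + j + 1 : ℕ) : ℂ) - b + 1 = 1 - ((m + j : ℕ) : ℂ) - b by push_cast; ring,
      mul_assoc, ih]
    push_cast
    ring

open Filter Topology in
theorem summable_aux (a b x : ℂ) (h : ∀ k : ℕ, b ≠ -(k : ℂ)) :
    Summable (fun k : ℕ => ‖pochC a k * x ^ k / (pochC b k * (Nat.factorial k : ℂ))‖) := by
  have hb : ∀ n : ℕ, b + (n : ℂ) ≠ 0 := fun n h' => h n (eq_neg_of_add_eq_zero_left h')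
  have ht : Tendsto (fun n : ℕ =>
      ‖(1 + (a - b) * (b + (n : ℂ))⁻¹) * (x * (1 + (n : ℂ))⁻¹)‖) atTop (𝓝 0) := by
    have := ((((inv_tendsto_aux b).const_mul (a - b)).const_add 1).mul
      ((inv_tendsto_aux 1).const_mul x)).norm
    simpa using this
  apply summable_of_ratio_norm_eventually_le (r := 1 / 2) (by norm_num)
  filter_upwards [ht.eventually (ge_mem_nhds (show (0 : ℝ) < 1 / 2 by norm_num))] with n hn
  rw [norm_norm, norm_norm]
  have key : pochC a (n + 1) * x ^ (n + 1) / (pochC b (n + 1) * (Nat.factorial (n + 1) : ℂ))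
      = ((1 + (a - b) * (b + (n : ℂ))⁻¹) * (x * (1 + (n : ℂ))⁻¹)) *
        (pochC a n * x ^ n / (pochC b n * (Nat.factorial n : ℂ))) := by
    rw [pochC_succ, pochC_succ, Nat.factorial_succ]
    have h1 := hb n
    have h2 := pochC_ne_zero b h n
    have h3 : (Nat.factorial n : ℂ) ≠ 0 := by exact_mod_cast Nat.factorial_ne_zero n
    have h4 : (1 + (n : ℂ)) ≠ 0 := by
      rw [add_comm]; exact Nat.cast_add_one_ne_zero n
    have h5 : ((n : ℂ) + 1) ≠ 0 := Nat.cast_add_one_ne_zero n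
    push_cast
    field_simp
    ring
  rw [key, norm_mul]
  exact mul_le_mul_of_nonneg_right hn (norm_nonneg _)

theorem stmt7 (a b c d : ℂ)
    (ha : ∀ m : ℤ, a ≠ (m : ℂ))
    (hb : ∀ m : ℤ, b ≠ (m : ℂ))
    (hd : ∀ k : ℕ, d ≠ -(k : ℂ)) :
    ∀ x : ℂ,
      hyp1F1 a b x * hyp1F1 c d (-x)
        = ∑' k : ℕ,
            pochC a k * x ^ k / ((Nat.factorial k : ℂ) * pochC b k) *
              ∑ j ∈ Finset.range (k + 1),
                pochC (-(k : ℂ)) j * pochC (1 - (k : ℂ) - b) j * pochC c j /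
                  (pochC (1 - (k : ℂ) - a) j * pochC d j * (Nat.factorial j : ℂ)) := by
  intro x
  have ha' : ∀ k : ℕ, a ≠ -(k : ℂ) := fun k => by simpa using ha (-(k : ℤ))
  have hb' : ∀ k : ℕ, b ≠ -(k : ℂ) := fun k => by simpa using hb (-(k : ℤ))
  unfold hyp1F1
  rw [tsum_mul_tsum_eq_tsum_sum_antidiagonal_of_summable_norm
    (summable_aux a b x hb') (summable_aux c d (-x) hd)]
  refine tsum_congr fun k => ?_
  rw [← Finset.Nat.sum_antidiagonal_swap, Finset.Nat.sum_antidiagonal_eq_sum_range_succ_mk,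
    Finset.mul_sum]
  refine Finset.sum_congr rfl fun j hj => ?_
  obtain ⟨m, rfl⟩ : ∃ m, k = m + j :=
    ⟨k - j, by have := Finset.mem_range.mp hj; omega⟩
  simp only [Prod.swap, Nat.add_sub_cancel]
  have ea := pochC_reverse a m j
  have eb := pochC_reverse b m j
  have e1 := pochC_reverse 1 m j
  rw [pochC_one, pochC_one, show 1 - ((m + j : ℕ) : ℂ) - 1 = -((m + j : ℕ) : ℂ) by ring] at e1
  have na := pochC_ne_zero a ha' m
  have na2 := pochC_ne_zero a ha' (m + j)
  have nb := pochC_ne_zero b hb' m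
  have nb2 := pochC_ne_zero b hb' (m + j)
  have nd := pochC_ne_zero d hd j
  have f1 : (Nat.factorial m : ℂ) ≠ 0 := by exact_mod_cast Nat.factorial_ne_zero m
  have f2 : (Nat.factorial j : ℂ) ≠ 0 := by exact_mod_cast Nat.factorial_ne_zero j
  have f3 : (Nat.factorial (m + j) : ℂ) ≠ 0 := by exact_mod_cast Nat.factorial_ne_zero (m + j)
  rw [eq_div_of_mul_eq na ea, eq_div_of_mul_eq nb eb, eq_div_of_mul_eq f1 e1, neg_pow x j, pow_add]
  have hs : ((-1 : ℂ)) ^ j ≠ 0 := pow_ne_zero _ (by norm_num)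
  generalize ((-1 : ℂ)) ^ j = s at *
  field_simp
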